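/- Fix reals λ > 0, w > 0, t > 0 and define p1 = λw/(1+λw), τ1 = w/(1+λw), τ2 = t/(1+λt). Then the system of four equations in the unknowns (ρ11, ρ21, ρ22, p_s): (i) p_s = ρ11 + ρ21 + ρ22, (ii) ρ11 = λ(1−p_s)τ1, (iii) ρ21 = λ(1−p_s)·p1·τ1, (iv) ρ22 = λ(1−p_s)·p1·(1−p1)·τ2, has a unique real solution, and it is given in closed form by ρ11 = λw / (1 + λw·(2 + λw/(1+λw) + λt/((1+λw)(1+λt)))), ρ21 = ρ11·λw/(1+λw), ρ22 = ρ11·λt/((1+λw)(1+λt)), and p_s = ρ11 + ρ21 + ρ22. -/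

import Mathlib

/-- The fixed-point system for the taker-existence probabilities `ρ11, ρ21, ρ22` and the
seeker matching probability `p_s` has a unique real solution, given in closed form. -/
theorem matching_fixed_point_unique_solution (lam w t : ℝ)
    (hlam : 0 < lam) (hw : 0 < w) (ht : 0 < t)
    (p1 τ1 τ2 : ℝ)
    (hp1 : p1 = lam * w / (1 + lam * w))
    (hτ1 : τ1 = w / (1 + lam * w))
    (hτ2 : τ2 = t / (1 + lam * t)) :
    ∀ ρ11 ρ21 ρ22 ps : ℝ,
      (ps = ρ11 + ρ21 + ρ22 ∧
        ρ11 = lam * (1 - ps) * τ1 ∧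
        ρ21 = lam * (1 - ps) * p1 * τ1 ∧
        ρ22 = lam * (1 - ps) * p1 * (1 - p1) * τ2) ↔
      (ρ11 = lam * w /
          (1 + lam * w * (2 + lam * w / (1 + lam * w) +
            lam * t / ((1 + lam * w) * (1 + lam * t)))) ∧
        ρ21 = ρ11 * (lam * w / (1 + lam * w)) ∧
        ρ22 = ρ11 * (lam * t / ((1 + lam * w) * (1 + lam * t))) ∧
        ps = ρ11 + ρ21 + ρ22) := by
  intro ρ11 ρ21 ρ22 ps
  have hx : 0 < lam * w := mul_pos hlam hw
  have hy : 0 < lam * t := mul_pos hlam ht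
  have hx1 : (1 + lam * w) ≠ 0 := by positivity
  have hy1 : (1 + lam * t) ≠ 0 := by positivity
  have e1 : ∀ k : ℝ, lam * k * p1 * τ1 = (lam * k * τ1) * (lam * w / (1 + lam * w)) := by
    intro k
    rw [hp1]; ring
  have e2 : ∀ k : ℝ, lam * k * p1 * (1 - p1) * τ2 =
      (lam * k * τ1) * (lam * t / ((1 + lam * w) * (1 + lam * t))) := by
    intro k
    rw [hp1, hτ1, hτ2]
    field_simp
    ring
  have e3 : ∀ k r : ℝ, r = lam * k * τ1 ↔ r * (1 + lam * w) = lam * w * k := by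
    intro k r
    have : lam * k * τ1 = lam * w * k / (1 + lam * w) := by rw [hτ1]; ring
    rw [this, eq_div_iff hx1]
  rw [e1, e2]
  have ha : 0 < lam * w / (1 + lam * w) := by positivity
  have hb : 0 < lam * t / ((1 + lam * w) * (1 + lam * t)) := by positivity
  generalize lam * w / (1 + lam * w) = a at *
  generalize lam * t / ((1 + lam * w) * (1 + lam * t)) = b at *
  have hD : 1 + lam * w * (2 + a + b) ≠ 0 := by positivity
  rw [eq_div_iff hD]
  constructor
  · rintro ⟨h1, h2, h3, h4⟩
    rw [← h2] at h3 h4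
    refine ⟨?_, h3, h4, h1⟩
    rw [e3, h1, h3, h4] at h2
    linear_combination h2
  · rintro ⟨h1, h2, h3, h4⟩
    have h5 : ρ11 = lam * (1 - ps) * τ1 := by
      rw [e3, h4, h2, h3]
      linear_combination h1
    rw [← h5]
    exact ⟨h4, rfl, h2, h3⟩
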